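/- arXiv:1901.01938 — 11 statements merged into one kernel-verified Lean document; each statement's English description precedes it below -/
import Mathlib

section
/- Let n ≥ 1, let (T_k) be a sequence of positive real numbers tending to +∞, let χ be a real number, and let (g_k) be a sequence of invertible linear endomorphisms of the Euclidean space ℝⁿ. Then (g_k) is uniformly (T_k)-Lyapunov regular with exponent χ if and only if (1/T_k)·log|det g_k| → n·χ and (1/T_k)·log‖g_k‖ → χ as k → ∞, where ‖g_k‖ is the operator norm. -/
open Filter Topology

/-- A sequence `g` of invertible linear endomorphisms of Euclidean `ℝⁿ` is uniformly
`(T_k)`-Lyapunov regular with exponent `χ` if `(1/T_k)·log ‖g_k v‖ → χ` for every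
nonzero `v`, and `(1/T_k)·log |det g_k| → n·χ`. -/
def UniformlyLyapunovRegular (n : ℕ) (T : ℕ → ℝ) (χ : ℝ)
    (g : ℕ → EuclideanSpace ℝ (Fin n) ≃L[ℝ] EuclideanSpace ℝ (Fin n)) : Prop :=
  (∀ v : EuclideanSpace ℝ (Fin n), v ≠ 0 →
      Tendsto (fun k => (1 / T k) * Real.log ‖g k v‖) atTop (nhds χ)) ∧
    Tendsto (fun k => (1 / T k) *
        Real.log |LinearMap.det
          (((g k : EuclideanSpace ℝ (Fin n) →L[ℝ] EuclideanSpace ℝ (Fin n))) :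
            EuclideanSpace ℝ (Fin n) →ₗ[ℝ] EuclideanSpace ℝ (Fin n))|)
      atTop (nhds ((n : ℝ) * χ))

/-- Hadamard's inequality for an endomorphism, isolating one direction `v`. -/
theorem abs_det_mul_norm_le {m : ℕ}
    (f : EuclideanSpace ℝ (Fin (m + 1)) →L[ℝ] EuclideanSpace ℝ (Fin (m + 1)))
    (v : EuclideanSpace ℝ (Fin (m + 1))) :
    |LinearMap.det (f : EuclideanSpace ℝ (Fin (m + 1)) →ₗ[ℝ] EuclideanSpace ℝ (Fin (m + 1)))| * ‖v‖
      ≤ ‖f v‖ * ‖f‖ ^ m := by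
  rcases eq_or_ne v 0 with rfl | hv
  · simp
  have hv' : 0 < ‖v‖ := norm_pos_iff.mpr hv
  have : Fact (Module.finrank ℝ (EuclideanSpace ℝ (Fin (m + 1))) = m + 1) := ⟨by simp⟩
  have hon : Orthonormal ℝ (({0} : Set (Fin (m + 1))).domRestrict
      (fun _ : Fin (m + 1) => ‖v‖⁻¹ • v)) := by
    refine ⟨fun i => ?_, fun i j hij => absurd (Subsingleton.elim i j) hij⟩
    change ‖‖v‖⁻¹ • v‖ = 1
    rw [norm_smul, norm_inv, norm_norm, inv_mul_cancel₀ hv'.ne']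
  obtain ⟨b, hb⟩ := hon.exists_orthonormalBasis_extension_of_card_eq (by simp)
  have hb0 : b 0 = ‖v‖⁻¹ • v := hb 0 rfl
  have hle := b.toBasis.orientation.abs_volumeForm_apply_le (fun i => f (b i))
  rw [Orientation.volumeForm_robust' _ b] at hle
  have hdet : b.toBasis.det (fun i => f (b i)) = LinearMap.det
      (f : EuclideanSpace ℝ (Fin (m + 1)) →ₗ[ℝ] EuclideanSpace ℝ (Fin (m + 1))) := by
    have := b.toBasis.det_comp
      (f : EuclideanSpace ℝ (Fin (m + 1)) →ₗ[ℝ] EuclideanSpace ℝ (Fin (m + 1))) b.toBasis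
    rw [Module.Basis.det_self, mul_one] at this
    rw [← this]
    congr 1
  rw [hdet, Fin.prod_univ_succ, hb0, map_smul, norm_smul, norm_inv, norm_norm] at hle
  have hprod : ∏ i : Fin m, ‖f (b i.succ)‖ ≤ ‖f‖ ^ m := by
    calc ∏ i : Fin m, ‖f (b i.succ)‖ ≤ ∏ _i : Fin m, ‖f‖ :=
          Finset.prod_le_prod (fun _ _ => norm_nonneg _) fun i _ => by
            simpa using f.le_opNorm (b i.succ)
      _ = ‖f‖ ^ m := by simp
  calc _ ≤ (‖v‖⁻¹ * ‖f v‖ * ∏ i : Fin m, ‖f (b i.succ)‖) * ‖v‖ := by gcongr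
    _ = ‖f v‖ * ∏ i : Fin m, ‖f (b i.succ)‖ := by field_simp
    _ ≤ _ := by gcongr

/-- The operator norm is at most the sum of the norms of the images of the standard basis. -/
theorem opNorm_le_sum_norm_single {n : ℕ}
    (f : EuclideanSpace ℝ (Fin n) →L[ℝ] EuclideanSpace ℝ (Fin n)) :
    ‖f‖ ≤ ∑ i, ‖f (EuclideanSpace.single i 1)‖ := by
  refine f.opNorm_le_bound (Finset.sum_nonneg fun _ _ => norm_nonneg _) fun x => ?_
  have hx : x = ∑ i, x i • EuclideanSpace.single i (1 : ℝ) := by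
    simpa using ((EuclideanSpace.basisFun (Fin n) ℝ).sum_repr x).symm
  calc ‖f x‖ = ‖∑ i, x i • f (EuclideanSpace.single i 1)‖ := by
        conv_lhs => rw [hx, map_sum]
        simp only [map_smul]
    _ ≤ ∑ i, ‖x i • f (EuclideanSpace.single i 1)‖ := norm_sum_le _ _
    _ ≤ ∑ i, ‖f (EuclideanSpace.single i 1)‖ * ‖x‖ := by
        refine Finset.sum_le_sum fun i _ => ?_
        rw [norm_smul, mul_comm]
        gcongr
        exact PiLp.norm_apply_le x i
    _ = _ := by rw [Finset.sum_mul]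

theorem stmt0 (n : ℕ) (hn : 1 ≤ n) (T : ℕ → ℝ) (hTpos : ∀ k, 0 < T k)
    (hT : Tendsto T atTop atTop) (χ : ℝ)
    (g : ℕ → EuclideanSpace ℝ (Fin n) ≃L[ℝ] EuclideanSpace ℝ (Fin n)) :
    UniformlyLyapunovRegular n T χ g ↔
      (Tendsto (fun k => (1 / T k) *
          Real.log |LinearMap.det
            (((g k : EuclideanSpace ℝ (Fin n) →L[ℝ] EuclideanSpace ℝ (Fin n))) :
              EuclideanSpace ℝ (Fin n) →ₗ[ℝ] EuclideanSpace ℝ (Fin n))|)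
        atTop (nhds ((n : ℝ) * χ)) ∧
      Tendsto (fun k => (1 / T k) *
          Real.log ‖(g k : EuclideanSpace ℝ (Fin n) →L[ℝ] EuclideanSpace ℝ (Fin n))‖)
        atTop (nhds χ)) := by
  obtain ⟨m, rfl⟩ : ∃ m, n = m + 1 := ⟨n - 1, by omega⟩
  have hinv : Tendsto (fun k => 1 / T k) atTop (𝓝 0) := by
    simp only [one_div]
    exact hT.inv_tendsto_atTop
  have hconst : ∀ c : ℝ, Tendsto (fun k => (1 / T k) * c) atTop (𝓝 0) := fun c => by
    simpa using hinv.mul_const c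
  have hTinv : ∀ k, 0 < 1 / T k := fun k => one_div_pos.mpr (hTpos k)
  have hgv : ∀ k v, v ≠ 0 → 0 < ‖g k v‖ := fun k v hv => by simpa using hv
  have hle : ∀ k v, ‖g k v‖ ≤ ‖(g k : EuclideanSpace ℝ (Fin (m + 1)) →L[ℝ]
      EuclideanSpace ℝ (Fin (m + 1)))‖ * ‖v‖ := fun k v =>
    (g k : EuclideanSpace ℝ (Fin (m + 1)) →L[ℝ] EuclideanSpace ℝ (Fin (m + 1))).le_opNorm v
  have he : ∀ i : Fin (m + 1), EuclideanSpace.single i (1 : ℝ) ≠ 0 := fun i => by simp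
  have hg : ∀ k, 0 < ‖(g k : EuclideanSpace ℝ (Fin (m + 1)) →L[ℝ]
      EuclideanSpace ℝ (Fin (m + 1)))‖ := fun k => by
    simpa using (hgv k _ (he 0)).trans_le (hle k _)
  constructor
  · rintro ⟨hv, hdet⟩
    refine ⟨hdet, tendsto_order.mpr ⟨fun a ha => ?_, fun a ha => ?_⟩⟩
    · filter_upwards [(hv _ (he 0)).eventually (lt_mem_nhds ha)] with k hk
      refine hk.trans_le ?_
      have := hTinv k
      gcongr
      · exact hgv k _ (he 0)
      · simpa using hle k (EuclideanSpace.single 0 1)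
    · obtain ⟨c, hc, hca⟩ := exists_between ha
      have h1 : ∀ᶠ k in atTop, ∀ i : Fin (m + 1),
          (1 / T k) * Real.log ‖g k (EuclideanSpace.single i 1)‖ < c :=
        eventually_all.mpr fun i => (hv _ (he i)).eventually (gt_mem_nhds hc)
      have h2 := (hconst (Real.log (m + 1 : ℝ))).eventually (gt_mem_nhds (sub_pos.mpr hca))
      filter_upwards [h1, h2] with k hk hk2
      have hexp : ∀ i : Fin (m + 1), ‖g k (EuclideanSpace.single i 1)‖ ≤ Real.exp (T k * c) := by
        intro i
        rw [← Real.log_le_iff_le_exp (hgv k _ (he i))]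
        have := hk i
        rw [one_div, inv_mul_lt_iff₀ (hTpos k)] at this
        exact this.le
      have hsum : ‖(g k : EuclideanSpace ℝ (Fin (m + 1)) →L[ℝ]
          EuclideanSpace ℝ (Fin (m + 1)))‖ ≤ (m + 1 : ℝ) * Real.exp (T k * c) := by
        refine (opNorm_le_sum_norm_single _).trans ?_
        refine (Finset.sum_le_sum fun i _ => hexp i).trans ?_
        simp
      have hlog := Real.log_le_log (hg k) hsum
      rw [Real.log_mul (by positivity) (by positivity), Real.log_exp] at hlog
      have h3 := mul_le_mul_of_nonneg_left hlog (hTinv k).le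
      have h4 : (1 / T k) * (T k * c) = c := by
        have := (hTpos k).ne'
        field_simp
      rw [mul_add, h4] at h3
      linarith
  · rintro ⟨hdet, hnorm⟩
    refine ⟨fun v hv => ?_, hdet⟩
    have hv' : 0 < ‖v‖ := norm_pos_iff.mpr hv
    have hlow := (hdet.add (hconst (Real.log ‖v‖))).sub (hnorm.const_mul (m : ℝ))
    have hupp := hnorm.add (hconst (Real.log ‖v‖))
    rw [show ((m + 1 : ℕ) : ℝ) * χ + 0 - m * χ = χ by push_cast; ring] at hlow
    rw [add_zero] at hupp
    refine tendsto_of_tendsto_of_tendsto_of_le_of_le hlow hupp (fun k => ?_) (fun k => ?_)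
    · have hd : 0 < |LinearMap.det (((g k : EuclideanSpace ℝ (Fin (m + 1)) →L[ℝ]
          EuclideanSpace ℝ (Fin (m + 1)))) : EuclideanSpace ℝ (Fin (m + 1)) →ₗ[ℝ]
            EuclideanSpace ℝ (Fin (m + 1)))| :=
        abs_pos.mpr (LinearEquiv.isUnit_det' (g k).toLinearEquiv).ne_zero
      have hlog := Real.log_le_log (mul_pos hd hv') (abs_det_mul_norm_le (g k :
        EuclideanSpace ℝ (Fin (m + 1)) →L[ℝ] EuclideanSpace ℝ (Fin (m + 1))) v)
      rw [ContinuousLinearEquiv.coe_coe, Real.log_mul hd.ne' hv'.ne',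
        Real.log_mul (hgv k v hv).ne' (pow_pos (hg k) m).ne',
        Real.log_pow] at hlog
      have h3 := mul_le_mul_of_nonneg_left hlog (hTinv k).le
      linarith
    · have hlog := Real.log_le_log (hgv k v hv) (hle k v)
      rw [Real.log_mul (hg k).ne' hv'.ne'] at hlog
      have h3 := mul_le_mul_of_nonneg_left hlog (hTinv k).le
      linarith
end

section
/- Let n ≥ 1, let (T_k) be a sequence of positive real numbers tending to +∞, let χ be a real number, and let (g_k), (l_k), (l_k') be sequences of invertible linear endomorphisms of the Euclidean space ℝⁿ such that there is a constant C with ‖l_k‖ ≤ C, ‖l_k⁻¹‖ ≤ C, ‖l_k'‖ ≤ C and ‖l_k'⁻¹‖ ≤ C for all k. If (g_k) is uniformly (T_k)-Lyapunov regular with exponent χ, then the sequence (l_k ∘ g_k ∘ l_k') is also uniformly (T_k)-Lyapunov regular with exponent χ. -/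
open Filter Topology

/-- **Hadamard's inequality**: the determinant is bounded by the product of the norms of the images
of an orthonormal basis. -/
theorem abs_det_le_prod_norm {n : ℕ}
    (f : EuclideanSpace ℝ (Fin n) →L[ℝ] EuclideanSpace ℝ (Fin n))
    (b : OrthonormalBasis (Fin n) ℝ (EuclideanSpace ℝ (Fin n))) :
    |LinearMap.det (f : EuclideanSpace ℝ (Fin n) →ₗ[ℝ] EuclideanSpace ℝ (Fin n))| ≤
      ∏ i, ‖f (b i)‖ := by
  have : Fact (Module.finrank ℝ (EuclideanSpace ℝ (Fin n)) = n) := ⟨by simp⟩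
  have h := b.toBasis.orientation.abs_volumeForm_apply_le (fun i => f (b i))
  rw [Orientation.volumeForm_robust' _ b] at h
  have h2 := b.toBasis.det_comp
    (f : EuclideanSpace ℝ (Fin n) →ₗ[ℝ] EuclideanSpace ℝ (Fin n)) b.toBasis
  rw [b.toBasis.det_self, mul_one] at h2
  rw [← h2]
  convert h using 3
  ext i
  simp

theorem abs_det_le_opNorm_pow {n : ℕ}
    (f : EuclideanSpace ℝ (Fin n) →L[ℝ] EuclideanSpace ℝ (Fin n)) :
    |LinearMap.det (f : EuclideanSpace ℝ (Fin n) →ₗ[ℝ] EuclideanSpace ℝ (Fin n))| ≤ ‖f‖ ^ n := by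
  refine (abs_det_le_prod_norm f (EuclideanSpace.basisFun (Fin n) ℝ)).trans ?_
  calc _ ≤ ∏ _i : Fin n, ‖f‖ := Finset.prod_le_prod (fun _ _ => norm_nonneg _) fun i _ =>
          f.unit_le_opNorm _ (OrthonormalBasis.norm_eq_one _ i).le
    _ = _ := by simp

theorem opNorm_le_card_mul_of_basisFun {n : ℕ}
    (f : EuclideanSpace ℝ (Fin n) →L[ℝ] EuclideanSpace ℝ (Fin n)) {M : ℝ} (hM : 0 ≤ M)
    (h : ∀ i, ‖f (EuclideanSpace.basisFun (Fin n) ℝ i)‖ ≤ M) : ‖f‖ ≤ n * M := by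
  refine f.opNorm_le_bound (by positivity) fun v => ?_
  conv_lhs => rw [← (EuclideanSpace.basisFun (Fin n) ℝ).sum_repr v, map_sum]
  calc _ ≤ ∑ _i : Fin n, ‖v‖ * M := norm_sum_le_of_le _ fun i _ => by
          rw [map_smul, norm_smul]
          gcongr
          · exact PiLp.norm_apply_le v i
          · exact h i
    _ = _ := by simp; ring

theorem tendsto_one_div_mul_of_abs_le {T b : ℕ → ℝ} (hT : Tendsto T atTop atTop) {B : ℝ}
    (hb : ∀ k, |b k| ≤ B) : Tendsto (fun k => (1 / T k) * b k) atTop (𝓝 0) := by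
  have h0 : Tendsto (fun k => 1 / T k) atTop (𝓝 0) := by
    simpa only [one_div] using! hT.inv_tendsto_atTop
  exact h0.zero_mul_isBoundedUnder_le (isBoundedUnder_of ⟨B, fun k => by simpa using hb k⟩)

theorem abs_log_abs_det_le {n : ℕ} {C : ℝ}
    (e : EuclideanSpace ℝ (Fin n) ≃L[ℝ] EuclideanSpace ℝ (Fin n))
    (h : ‖(e : EuclideanSpace ℝ (Fin n) →L[ℝ] EuclideanSpace ℝ (Fin n))‖ ≤ C)
    (h' : ‖(e.symm : EuclideanSpace ℝ (Fin n) →L[ℝ] EuclideanSpace ℝ (Fin n))‖ ≤ C) :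
    |(Real.log |LinearMap.det ((e : EuclideanSpace ℝ (Fin n) →L[ℝ] EuclideanSpace ℝ (Fin n)) :
      EuclideanSpace ℝ (Fin n) →ₗ[ℝ] EuclideanSpace ℝ (Fin n))|)| ≤ n * Real.log C := by
  have hmul : LinearMap.det
      ((e.symm : EuclideanSpace ℝ (Fin n) →L[ℝ] EuclideanSpace ℝ (Fin n)) :
        EuclideanSpace ℝ (Fin n) →ₗ[ℝ] EuclideanSpace ℝ (Fin n)) *
      LinearMap.det ((e : EuclideanSpace ℝ (Fin n) →L[ℝ] EuclideanSpace ℝ (Fin n)) :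
        EuclideanSpace ℝ (Fin n) →ₗ[ℝ] EuclideanSpace ℝ (Fin n)) = 1 :=
    e.toLinearEquiv.det_symm_mul_det
  have h1 := (abs_det_le_opNorm_pow (e : EuclideanSpace ℝ (Fin n) →L[ℝ] EuclideanSpace ℝ (Fin n))).trans
    (pow_le_pow_left₀ (norm_nonneg _) h n)
  have h2 := (abs_det_le_opNorm_pow (e.symm : EuclideanSpace ℝ (Fin n) →L[ℝ] EuclideanSpace ℝ (Fin n))).trans
    (pow_le_pow_left₀ (norm_nonneg _) h' n)
  have hne := right_ne_zero_of_mul_eq_one hmul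
  have hne' := left_ne_zero_of_mul_eq_one hmul
  have l1 := Real.log_le_log (abs_pos.mpr hne) h1
  have l2 := Real.log_le_log (abs_pos.mpr hne') h2
  have l3 := congrArg Real.log (congrArg abs hmul)
  rw [abs_mul, Real.log_mul (abs_ne_zero.mpr hne') (abs_ne_zero.mpr hne), abs_one,
    Real.log_one] at l3
  rw [Real.log_pow] at l1 l2
  exact abs_le.mpr ⟨by linarith, l1⟩

theorem UniformlyLyapunovRegular.tendsto_log_opNorm {n : ℕ} (hn : 1 ≤ n) {T : ℕ → ℝ}
    (hTpos : ∀ k, 0 < T k) (hT : Tendsto T atTop atTop) {χ : ℝ}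
    {g : ℕ → EuclideanSpace ℝ (Fin n) ≃L[ℝ] EuclideanSpace ℝ (Fin n)}
    (hreg : UniformlyLyapunovRegular n T χ g) :
    Tendsto (fun k => (1 / T k) *
      Real.log ‖(g k : EuclideanSpace ℝ (Fin n) →L[ℝ] EuclideanSpace ℝ (Fin n))‖)
      atTop (𝓝 χ) := by
  set b := EuclideanSpace.basisFun (Fin n) ℝ
  have hb : ∀ i, b i ≠ 0 := fun i => b.orthonormal.ne_zero i
  have hne : (Finset.univ : Finset (Fin n)).Nonempty := ⟨⟨0, hn⟩, Finset.mem_univ _⟩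
  have hpos : ∀ k i, 0 < ‖g k (b i)‖ := fun k i =>
    norm_pos_iff.mpr ((g k).map_ne_zero_iff.mpr (hb i))
  have hle : ∀ k i, ‖g k (b i)‖ ≤
      ‖(g k : EuclideanSpace ℝ (Fin n) →L[ℝ] EuclideanSpace ℝ (Fin n))‖ := fun k i =>
    (g k : EuclideanSpace ℝ (Fin n) →L[ℝ] EuclideanSpace ℝ (Fin n)).unit_le_opNorm _
      (b.norm_eq_one i).le
  have hsup : Tendsto
      (fun k => Finset.univ.sup' hne fun i => (1 / T k) * Real.log ‖g k (b i)‖)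
      atTop (𝓝 χ) := by
    have h := Tendsto.finset_sup'_nhds_apply hne fun i _ => hreg.1 (b i) (hb i)
    rwa [Finset.sup'_const] at h
  have hupper := (tendsto_one_div_mul_of_abs_le hT fun _ => le_refl |Real.log n|).add hsup
  rw [zero_add] at hupper
  refine tendsto_of_tendsto_of_tendsto_of_le_of_le (hreg.1 _ (hb ⟨0, hn⟩)) hupper
    (fun k => ?_) (fun k => ?_)
  · have := hTpos k
    exact mul_le_mul_of_nonneg_left (Real.log_le_log (hpos k _) (hle k _)) (by positivity)
  · have hk := hTpos k
    set S := Finset.univ.sup' hne fun i => (1 / T k) * Real.log ‖g k (b i)‖ with hS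
    have hg : ‖(g k : EuclideanSpace ℝ (Fin n) →L[ℝ] EuclideanSpace ℝ (Fin n))‖ ≤
        n * Real.exp (T k * S) := by
      refine opNorm_le_card_mul_of_basisFun _ (Real.exp_pos _).le fun i => ?_
      refine (Real.log_le_iff_le_exp (hpos k i)).mp ?_
      have : (1 / T k) * Real.log ‖g k (b i)‖ ≤ S :=
        Finset.le_sup' (fun i => (1 / T k) * Real.log ‖g k (b i)‖) (Finset.mem_univ i)
      rwa [one_div_mul_eq_div, div_le_iff₀' hk] at this
    have hlog := Real.log_le_log ((hpos k ⟨0, hn⟩).trans_le (hle k _)) hg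
    rw [Real.log_mul (by positivity) (Real.exp_pos _).ne', Real.log_exp] at hlog
    calc _ ≤ (1 / T k) * (Real.log n + T k * S) := by gcongr
      _ = _ := by field_simp

theorem stmt1 (n : ℕ) (hn : 1 ≤ n) (T : ℕ → ℝ) (hTpos : ∀ k, 0 < T k)
    (hT : Tendsto T atTop atTop) (χ : ℝ)
    (g l l' : ℕ → EuclideanSpace ℝ (Fin n) ≃L[ℝ] EuclideanSpace ℝ (Fin n))
    (C : ℝ)
    (hbound : ∀ k,
      ‖(l k : EuclideanSpace ℝ (Fin n) →L[ℝ] EuclideanSpace ℝ (Fin n))‖ ≤ C ∧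
      ‖((l k).symm : EuclideanSpace ℝ (Fin n) →L[ℝ] EuclideanSpace ℝ (Fin n))‖ ≤ C ∧
      ‖(l' k : EuclideanSpace ℝ (Fin n) →L[ℝ] EuclideanSpace ℝ (Fin n))‖ ≤ C ∧
      ‖((l' k).symm : EuclideanSpace ℝ (Fin n) →L[ℝ] EuclideanSpace ℝ (Fin n))‖ ≤ C)
    (hreg : UniformlyLyapunovRegular n T χ g) :
    UniformlyLyapunovRegular n T χ (fun k => ((l' k).trans (g k)).trans (l k)) := by
  refine ⟨fun v hv => ?_, ?_⟩
  · have hv' : 0 < ‖v‖ := norm_pos_iff.mpr hv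
    have hG := hreg.tendsto_log_opNorm hn hTpos hT
    obtain ⟨m, rfl⟩ : ∃ m, n = m + 1 := ⟨n - 1, by omega⟩
    have hl : ∀ k w, ‖l k w‖ ≤ C * ‖w‖ := fun k w =>
      ContinuousLinearMap.le_of_opNorm_le _ (hbound k).1 w
    have hls : ∀ k w, ‖w‖ ≤ C * ‖l k w‖ := fun k w => by
      simpa using ContinuousLinearMap.le_of_opNorm_le _ (hbound k).2.1 (l k w)
    have hl' : ∀ k w, ‖l' k w‖ ≤ C * ‖w‖ := fun k w =>
      ContinuousLinearMap.le_of_opNorm_le _ (hbound k).2.2.1 w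
    have hls' : ∀ k w, ‖w‖ ≤ C * ‖l' k w‖ := fun k w => by
      simpa using ContinuousLinearMap.le_of_opNorm_le _ (hbound k).2.2.2 (l' k w)
    have hC : 0 < C := pos_of_mul_pos_left (hv'.trans_le (hls' 0 v)) (norm_nonneg _)
    have hc := fun c : ℝ => tendsto_one_div_mul_of_abs_le hT fun _ => le_refl |c|
    have hlower := ((hc (Real.log ‖v‖ - 2 * Real.log C)).add hreg.2).sub (hG.const_mul (m : ℝ))
    have hupper := (hc (Real.log ‖v‖ + 2 * Real.log C)).add hG
    rw [show 0 + ((m + 1 : ℕ) : ℝ) * χ - m * χ = χ by push_cast; ring] at hlower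
    rw [zero_add] at hupper
    refine tendsto_of_tendsto_of_tendsto_of_le_of_le hlower hupper (fun k => ?_) (fun k => ?_)
    all_goals
      have hk : 0 < 1 / T k := one_div_pos.mpr (hTpos k)
      have hne : l k (g k (l' k v)) ≠ 0 := by simpa using hv
      have hpos : 0 < ‖l k (g k (l' k v))‖ := norm_pos_iff.mpr hne
      have hgv := (g k : EuclideanSpace ℝ (Fin (m + 1)) →L[ℝ]
        EuclideanSpace ℝ (Fin (m + 1))).le_opNorm (l' k v)
      have hdet := abs_det_mul_norm_le (g k : EuclideanSpace ℝ (Fin (m + 1)) →L[ℝ]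
        EuclideanSpace ℝ (Fin (m + 1))) (l' k v)
      simp only [ContinuousLinearEquiv.coe_coe] at hgv hdet
      have hg0 : 0 < ‖(g k : EuclideanSpace ℝ (Fin (m + 1)) →L[ℝ]
          EuclideanSpace ℝ (Fin (m + 1)))‖ := by
        refine pos_of_mul_pos_left ((norm_pos_iff.mpr ?_).trans_le hgv) (norm_nonneg _)
        simpa using hv
      set G := ‖(g k : EuclideanSpace ℝ (Fin (m + 1)) →L[ℝ] EuclideanSpace ℝ (Fin (m + 1)))‖
      simp only [ContinuousLinearEquiv.trans_apply]
    · set D := |LinearMap.det ((g k : EuclideanSpace ℝ (Fin (m + 1)) →L[ℝ]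
        EuclideanSpace ℝ (Fin (m + 1))) :
          EuclideanSpace ℝ (Fin (m + 1)) →ₗ[ℝ] EuclideanSpace ℝ (Fin (m + 1)))|
      have hD : 0 < D := abs_pos.mpr (g k).toLinearEquiv.isUnit_det'.ne_zero
      have h : D * ‖v‖ ≤ C * (C * ‖l k (g k (l' k v))‖ * G ^ m) := by
        calc D * ‖v‖ ≤ D * (C * ‖l' k v‖) := by gcongr; exact hls' k v
          _ = C * (D * ‖l' k v‖) := by ring
          _ ≤ C * (‖g k (l' k v)‖ * G ^ m) := by gcongr
          _ ≤ _ := by gcongr; exact hls k _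
      have hlog := Real.log_le_log (by positivity) h
      rw [Real.log_mul hD.ne' hv'.ne', Real.log_mul hC.ne' (by positivity),
        Real.log_mul (by positivity) (by positivity), Real.log_mul hC.ne' hpos.ne',
        Real.log_pow] at hlog
      calc _ = (1 / T k) * (Real.log ‖v‖ - 2 * Real.log C + Real.log D - m * Real.log G) := by
            ring
        _ ≤ _ := by gcongr; linarith
    · have h : ‖l k (g k (l' k v))‖ ≤ C * (G * (C * ‖v‖)) := by
        refine (hl k _).trans ?_
        gcongr
        refine hgv.trans ?_
        gcongr
        exact hl' k v
      have hlog := Real.log_le_log hpos h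
      rw [Real.log_mul hC.ne' (by positivity), Real.log_mul hg0.ne' (by positivity),
        Real.log_mul hC.ne' hv'.ne'] at hlog
      rw [← mul_add]
      gcongr
      linarith
  · have hl := tendsto_one_div_mul_of_abs_le hT fun k =>
      abs_log_abs_det_le (l k) (hbound k).1 (hbound k).2.1
    have hl' := tendsto_one_div_mul_of_abs_le hT fun k =>
      abs_log_abs_det_le (l' k) (hbound k).2.2.1 (hbound k).2.2.2
    have h := (hl.add hreg.2).add hl'
    rw [zero_add, add_zero] at h
    refine h.congr fun k => ?_
    have hdet : ∀ e : EuclideanSpace ℝ (Fin n) ≃L[ℝ] EuclideanSpace ℝ (Fin n),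
        |LinearMap.det ((e : EuclideanSpace ℝ (Fin n) →L[ℝ] EuclideanSpace ℝ (Fin n)) :
          EuclideanSpace ℝ (Fin n) →ₗ[ℝ] EuclideanSpace ℝ (Fin n))| ≠ 0 := fun e =>
      abs_ne_zero.mpr e.toLinearEquiv.isUnit_det'.ne_zero
    rw [← mul_add, ← mul_add, ← Real.log_mul (hdet _) (hdet _),
      ← Real.log_mul (mul_ne_zero (hdet _) (hdet _)) (hdet _), ← abs_mul, ← abs_mul,
      ← LinearMap.det_comp, ← LinearMap.det_comp]
    rfl
end

section
/- With the hypotheses of the context, the following hold: (1) c_i + c_{r+1−i} = c₀ for all 1 ≤ i ≤ r; (2) whenever i + j ≠ r + 1, B(u,v) = 0 for all u ∈ E_i and v ∈ E_j; (3) for every i with 2i < r + 1, the subspaces E_i and E_{r+1−i} are totally isotropic for B, dim E_i = dim E_{r+1−i}, and the restriction of B to E_i ⊕ E_{r+1−i} is nondegenerate; (4) if r is odd, the restriction of B to E_{(r+1)/2} is nondegenerate; (5) if r is even, every E_i is totally isotropic for B. -/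
/-- A subspace `W` is totally isotropic for the bilinear form `B` if `B u v = 0`
for all `u, v ∈ W`. -/
def TotallyIsotropic {V : Type*} [AddCommGroup V] [Module ℝ V]
    (B : LinearMap.BilinForm ℝ V) (W : Submodule ℝ V) : Prop :=
  ∀ u ∈ W, ∀ v ∈ W, B u v = 0

theorem Fin.eq_rev_of_strictAnti {r : ℕ} {σ : Fin r → Fin r} (hσ : StrictAnti σ) (i : Fin r) :
    σ i = i.rev := by
  have hmono : StrictMono fun j => (σ j).rev := fun a b hab => Fin.rev_lt_rev.mpr (hσ hab)
  rw [← Fin.rev_rev (σ i)]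
  exact congrArg Fin.rev (hmono.apply_le.antisymm hmono.le_apply)

section Orthogonality

variable {V : Type*} [AddCommGroup V] [Module ℝ V] {B : LinearMap.BilinForm ℝ V}

theorem eq_zero_of_orthogonal_iSup (hBnd : B.Nondegenerate) {ι : Type*}
    {E : ι → Submodule ℝ V} (hE : ⨆ i, E i = ⊤) {u : V}
    (hu : ∀ j, ∀ v ∈ E j, B u v = 0) : u = 0 := by
  have hle : ⨆ i, E i ≤ LinearMap.ker (B u) :=
    iSup_le fun j v hv => LinearMap.mem_ker.mpr (hu j v hv)
  exact hBnd.1 u fun v => LinearMap.mem_ker.mp (hle (hE ▸ Submodule.mem_top))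

theorem restrict_nondegenerate_of_symm (hBsymm : ∀ u v : V, B u v = B v u)
    {W : Submodule ℝ V} (hW : ∀ u ∈ W, (∀ v ∈ W, B u v = 0) → u = 0) :
    (B.restrict W).Nondegenerate :=
  ⟨fun u hu => Subtype.ext (hW u u.2 fun v hv => hu ⟨v, hv⟩),
    fun u hu => Subtype.ext (hW u u.2 fun v hv => (hBsymm u v).trans (hu ⟨v, hv⟩))⟩

theorem finrank_le_of_separating [FiniteDimensional ℝ V] {W W' : Submodule ℝ V}
    (hW : ∀ u ∈ W, (∀ v ∈ W', B u v = 0) → u = 0) :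
    Module.finrank ℝ W ≤ Module.finrank ℝ W' := by
  rw [← Subspace.dual_finrank_eq (K := ℝ) (V := W')]
  refine LinearMap.finrank_le_finrank_of_injective (f := B.domRestrict₁₂ W W') ?_
  refine (injective_iff_map_eq_zero _).mpr fun u hu => Subtype.ext (hW u u.2 fun v hv => ?_)
  exact LinearMap.congr_fun hu ⟨v, hv⟩

theorem restrict_sup_nondegenerate (hBsymm : ∀ u v : V, B u v = B v u) {W W' : Submodule ℝ V}
    (hWi : TotallyIsotropic B W) (hWi' : TotallyIsotropic B W')
    (hW : ∀ u ∈ W, (∀ v ∈ W', B u v = 0) → u = 0)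
    (hW' : ∀ u ∈ W', (∀ v ∈ W, B u v = 0) → u = 0) :
    (B.restrict (W ⊔ W')).Nondegenerate := by
  refine restrict_nondegenerate_of_symm hBsymm fun u hu h => ?_
  obtain ⟨a, ha, b, hb, rfl⟩ := Submodule.mem_sup.mp hu
  have ha0 : a = 0 := hW a ha fun v hv => by
    simpa [hWi' b hb v hv] using h v (Submodule.mem_sup_right hv)
  have hb0 : b = 0 := hW' b hb fun v hv => by
    simpa [hWi a ha v hv] using h v (Submodule.mem_sup_left hv)
  rw [ha0, hb0, add_zero]

end Orthogonality

theorem stmt3 {V : Type*} [AddCommGroup V] [Module ℝ V] [FiniteDimensional ℝ V]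
    (B : LinearMap.BilinForm ℝ V) (hBnd : B.Nondegenerate)
    (hBsymm : ∀ u v : V, B u v = B v u)
    (r : ℕ) (hr : 1 ≤ r)
    (E : Fin r → Submodule ℝ V) (hE : ∀ i, E i ≠ ⊥)
    (hdirect : DirectSum.IsInternal E)
    (c : Fin r → ℝ) (hc : StrictMono c) (c₀ : ℝ)
    (horth : ∀ i j : Fin r, c i + c j ≠ c₀ → ∀ u ∈ E i, ∀ v ∈ E j, B u v = 0) :
    (∀ i : Fin r, c i + c i.rev = c₀) ∧
    (∀ i j : Fin r, j ≠ i.rev → ∀ u ∈ E i, ∀ v ∈ E j, B u v = 0) ∧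
    (∀ i : Fin r, (i : ℕ) < (i.rev : ℕ) →
      TotallyIsotropic B (E i) ∧ TotallyIsotropic B (E i.rev) ∧
      Module.finrank ℝ (E i) = Module.finrank ℝ (E i.rev) ∧
      (B.restrict (E i ⊔ E i.rev)).Nondegenerate) ∧
    (Odd r → (B.restrict (E ⟨(r - 1) / 2, by omega⟩)).Nondegenerate) ∧
    (Even r → ∀ i : Fin r, TotallyIsotropic B (E i)) := by
  have htop := hdirect.submodule_iSup_eq_top
  have hpartner : ∀ i, ∃ j, c i + c j = c₀ := fun i => by
    by_contra! h
    obtain ⟨u, hu, hu0⟩ := Submodule.exists_mem_ne_zero_of_ne_bot (hE i)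
    exact hu0 (eq_zero_of_orthogonal_iSup hBnd htop fun j => horth i j (h j) u hu)
  choose σ hσ using hpartner
  have hanti : StrictAnti σ := fun a b hab => hc.lt_iff_lt.mp (by
    linarith [hσ a, hσ b, hc hab])
  have hsum : ∀ i : Fin r, c i + c i.rev = c₀ := fun i =>
    Fin.eq_rev_of_strictAnti hanti i ▸ hσ i
  have hoff : ∀ i j : Fin r, j ≠ i.rev → ∀ u ∈ E i, ∀ v ∈ E j, B u v = 0 := fun i j hij =>
    horth i j fun h => hij (hc.injective (by linarith [hsum i]))
  have hsep : ∀ i : Fin r, ∀ u ∈ E i, (∀ v ∈ E i.rev, B u v = 0) → u = 0 := fun i u hu h =>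
    eq_zero_of_orthogonal_iSup hBnd htop fun j v hv => by
      by_cases hj : j = i.rev
      · exact h v (hj ▸ hv)
      · exact hoff i j hj u hu v hv
  have hsep' : ∀ i : Fin r, ∀ u ∈ E i.rev, (∀ v ∈ E i, B u v = 0) → u = 0 := fun i => by
    simpa only [Fin.rev_rev] using hsep i.rev
  have hiso : ∀ i : Fin r, i ≠ i.rev → TotallyIsotropic B (E i) := fun i hi => hoff i i hi
  refine ⟨hsum, hoff, fun i hi => ?_, fun hodd => ?_, fun heven i => hiso i fun h => ?_⟩
  · have hne : i ≠ i.rev := Fin.ne_of_lt hi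
    have hi1 := hiso i hne
    have hi2 := hiso i.rev (by rw [Fin.rev_rev]; exact hne.symm)
    exact ⟨hi1, hi2,
      (finrank_le_of_separating (hsep i)).antisymm (finrank_le_of_separating (hsep' i)),
      restrict_sup_nondegenerate hBsymm hi1 hi2 (hsep i) (hsep' i)⟩
  · obtain ⟨k, hk⟩ := hodd
    have hrev : Fin.rev (⟨(r - 1) / 2, by omega⟩ : Fin r) = ⟨(r - 1) / 2, by omega⟩ :=
      Fin.ext (by simp only [Fin.val_rev]; omega)
    refine restrict_nondegenerate_of_symm hBsymm fun u hu h => hsep _ u hu ?_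
    rwa [hrev]
  · obtain ⟨k, hk⟩ := heven
    have := congrArg Fin.val h
    rw [Fin.val_rev] at this
    omega
end

section
/- With the hypotheses of the context, assume in addition that p is a natural number such that every subspace of V that is totally isotropic for B has dimension at most p. Then r ≤ 2p + 1. -/
/-- A subspace spanned by pairwise orthogonal isotropic vectors is totally isotropic. -/
theorem totallyIsotropic_span {V : Type*} [AddCommGroup V] [Module ℝ V]
    (B : LinearMap.BilinForm ℝ V) {s : Set V} (hs : ∀ u ∈ s, ∀ v ∈ s, B u v = 0) :
    TotallyIsotropic B (Submodule.span ℝ s) := by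
  intro u hu v hv
  induction hu, hv using Submodule.span_induction₂ with
  | mem_mem x y hx hy => exact hs x hx y hy
  | zero_left => simp
  | zero_right => simp
  | add_left x y z _ _ _ h₁ h₂ => simp [h₁, h₂]
  | add_right x y z _ _ _ h₁ h₂ => simp [h₁, h₂]
  | smul_left a x y _ _ h => simp [h]
  | smul_right a x y _ _ h => simp [h]

/-- Linearly independent, pairwise orthogonal isotropic vectors are at most as many as the
maximal dimension of a totally isotropic subspace. -/
theorem card_le_of_totallyIsotropic_finrank_le {V ι : Type*} [AddCommGroup V] [Module ℝ V]
    (B : LinearMap.BilinForm ℝ V) {e : ι → V} (he : LinearIndependent ℝ e) {p : ℕ}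
    (hp : ∀ W : Submodule ℝ V, TotallyIsotropic B W → Module.finrank ℝ W ≤ p)
    (s : Finset ι) (hs : ∀ i ∈ s, ∀ j ∈ s, B (e i) (e j) = 0) : s.card ≤ p := by
  have hli : LinearIndependent ℝ (fun i : s => e i) := he.comp _ Subtype.val_injective
  have hiso := totallyIsotropic_span B (s := Set.range fun i : s => e i) (by
    rintro _ ⟨i, rfl⟩ _ ⟨j, rfl⟩
    exact hs i i.2 j j.2)
  simpa [finrank_span_eq_card hli] using hp _ hiso

theorem stmt4 {V : Type*} [AddCommGroup V] [Module ℝ V] [FiniteDimensional ℝ V]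
    (B : LinearMap.BilinForm ℝ V) (hBnd : B.Nondegenerate)
    (hBsymm : ∀ u v : V, B u v = B v u)
    (r : ℕ) (hr : 1 ≤ r)
    (E : Fin r → Submodule ℝ V) (hE : ∀ i, E i ≠ ⊥)
    (hdirect : DirectSum.IsInternal E)
    (c : Fin r → ℝ) (hc : StrictMono c) (c₀ : ℝ)
    (horth : ∀ i j : Fin r, c i + c j ≠ c₀ → ∀ u ∈ E i, ∀ v ∈ E j, B u v = 0)
    (p : ℕ)
    (hp : ∀ W : Submodule ℝ V, TotallyIsotropic B W → Module.finrank ℝ W ≤ p) :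
    r ≤ 2 * p + 1 := by
  choose e heE he0 using fun i => (Submodule.ne_bot_iff (E i)).1 (hE i)
  have he : LinearIndependent ℝ e :=
    hdirect.submodule_iSupIndep.linearIndependent E heE he0
  have hlow : (Finset.univ.filter fun i => 2 * c i < c₀).card ≤ p := by
    refine card_le_of_totallyIsotropic_finrank_le B he hp _ fun i hi j hj => ?_
    simp only [Finset.mem_filter_univ] at hi hj
    exact horth i j (by linarith) _ (heE i) _ (heE j)
  have hhigh : (Finset.univ.filter fun i => c₀ < 2 * c i).card ≤ p := by
    refine card_le_of_totallyIsotropic_finrank_le B he hp _ fun i hi j hj => ?_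
    simp only [Finset.mem_filter_univ] at hi hj
    exact horth i j (by linarith) _ (heE i) _ (heE j)
  have hmid : (Finset.univ.filter fun i => 2 * c i = c₀).card ≤ 1 := by
    refine Finset.card_le_one.2 fun i hi j hj => hc.injective ?_
    simp only [Finset.mem_filter_univ] at hi hj
    linarith
  have hcover : (Finset.univ : Finset (Fin r)) ⊆
      ((Finset.univ.filter fun i => 2 * c i < c₀) ∪ (Finset.univ.filter fun i => c₀ < 2 * c i)) ∪
        (Finset.univ.filter fun i => 2 * c i = c₀) := by
    intro i _
    rcases lt_trichotomy (2 * c i) c₀ with h | h | h <;> simp [h]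
  have hcard := (Finset.card_le_card hcover).trans (Finset.card_union_le _ _)
  rw [Finset.card_univ, Fintype.card_fin] at hcard
  have hunion := Finset.card_union_le (Finset.univ.filter fun i => 2 * c i < c₀)
    (Finset.univ.filter fun i => c₀ < 2 * c i)
  omega
end

section
/- With the hypotheses of the context, assume in addition that for some index i₀ the subspace E_{i₀} is not totally isotropic for B. Then c₀ = 2c_{i₀}; the restriction of B to E_{i₀} is nondegenerate; B(u,v) = 0 for all u ∈ E_{i₀} and v ∈ E_j whenever j ≠ i₀; and the subspaces ⨁_{j<i₀} E_j and ⨁_{j>i₀} E_j are both totally isotropic for B and have equal dimension. -/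
/-- If no nonzero vector of `L` is orthogonal to `M`, then `dim L ≤ dim M`. -/
theorem finrank_le_of_separating_s5 {V : Type*} [AddCommGroup V] [Module ℝ V]
    [FiniteDimensional ℝ V] (B : LinearMap.BilinForm ℝ V) (L M : Submodule ℝ V)
    (h : ∀ u ∈ L, (∀ v ∈ M, B u v = 0) → u = 0) :
    Module.finrank ℝ L ≤ Module.finrank ℝ M := by
  rw [← Subspace.dual_finrank_eq (K := ℝ) (V := M)]
  refine LinearMap.finrank_le_finrank_of_injective (f := B.domRestrict₁₂ L M) ?_
  rw [injective_iff_map_eq_zero]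
  intro u hu
  refine Subtype.ext (h u u.2 fun v hv => ?_)
  exact LinearMap.congr_fun hu ⟨v, hv⟩

/-- Orthogonality to a supremum of subspaces can be checked on each of them. -/
theorem apply_eq_zero_of_mem_biSup {V ι : Type*} [AddCommGroup V] [Module ℝ V]
    (B : LinearMap.BilinForm ℝ V) (E : ι → Submodule ℝ V) (p : ι → Prop) (u : V)
    (h : ∀ j, p j → ∀ v ∈ E j, B u v = 0) :
    ∀ v ∈ ⨆ j, ⨆ (_ : p j), E j, B u v = 0 := fun _ hv =>
  (iSup₂_le (a := LinearMap.ker (B u)) h : (⨆ j, ⨆ (_ : p j), E j) ≤ _) hv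

theorem totallyIsotropic_biSup {V ι : Type*} [AddCommGroup V] [Module ℝ V]
    (B : LinearMap.BilinForm ℝ V) (hB : ∀ u v : V, B u v = B v u)
    (E : ι → Submodule ℝ V) (p : ι → Prop)
    (h : ∀ i j, p i → p j → ∀ u ∈ E i, ∀ v ∈ E j, B u v = 0) :
    TotallyIsotropic B (⨆ j, ⨆ (_ : p j), E j) := by
  intro u hu
  refine apply_eq_zero_of_mem_biSup B E p u fun j hj v hv => ?_
  rw [hB]
  exact apply_eq_zero_of_mem_biSup B E p v
    (fun i hi w hw => by rw [hB]; exact h i j hi hj w hw v hv) u hu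

theorem stmt5 {V : Type*} [AddCommGroup V] [Module ℝ V] [FiniteDimensional ℝ V]
    (B : LinearMap.BilinForm ℝ V) (hBnd : B.Nondegenerate)
    (hBsymm : ∀ u v : V, B u v = B v u)
    (r : ℕ) (hr : 1 ≤ r)
    (E : Fin r → Submodule ℝ V) (hE : ∀ i, E i ≠ ⊥)
    (hdirect : DirectSum.IsInternal E)
    (c : Fin r → ℝ) (hc : StrictMono c) (c₀ : ℝ)
    (horth : ∀ i j : Fin r, c i + c j ≠ c₀ → ∀ u ∈ E i, ∀ v ∈ E j, B u v = 0)
    (i₀ : Fin r) (hi₀ : ¬ TotallyIsotropic B (E i₀)) :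
    c₀ = 2 * c i₀ ∧
    (B.restrict (E i₀)).Nondegenerate ∧
    (∀ j : Fin r, j ≠ i₀ → ∀ u ∈ E i₀, ∀ v ∈ E j, B u v = 0) ∧
    TotallyIsotropic B (⨆ j < i₀, E j) ∧
    TotallyIsotropic B (⨆ j > i₀, E j) ∧
    Module.finrank ℝ ↥(⨆ j < i₀, E j) = Module.finrank ℝ ↥(⨆ j > i₀, E j) := by
  have hc₀ : c₀ = 2 * c i₀ := by
    by_contra hne
    exact hi₀ (horth i₀ i₀ fun h => hne (by linarith))
  have hmid : ∀ j : Fin r, j ≠ i₀ → ∀ u ∈ E i₀, ∀ v ∈ E j, B u v = 0 := fun j hj =>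
    horth i₀ j fun h => hj (hc.injective (by linarith))
  have hlow : TotallyIsotropic B (⨆ j < i₀, E j) :=
    totallyIsotropic_biSup B hBsymm E (· < i₀) fun i j hi hj =>
      horth i j (by linarith [hc hi, hc hj] : c i + c j < c₀).ne
  have hhigh : TotallyIsotropic B (⨆ j > i₀, E j) :=
    totallyIsotropic_biSup B hBsymm E (· > i₀) fun i j hi hj =>
      horth i j (by linarith [hc hi, hc hj] : c₀ < c i + c j).ne'
  have hzero : ∀ u, (∀ j, ∀ v ∈ E j, B u v = 0) → u = 0 := by
    intro u hu
    refine hBnd.1 u fun v => ?_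
    have hle : (⨆ j, E j) ≤ LinearMap.ker (B u) := iSup_le hu
    rw [hdirect.submodule_iSup_eq_top] at hle
    exact hle Submodule.mem_top
  have hmid_low : ∀ u ∈ ⨆ j < i₀, E j, ∀ v ∈ E i₀, B u v = 0 := fun u hu v hv => by
    rw [hBsymm]
    exact apply_eq_zero_of_mem_biSup B E (· < i₀) v (fun j hj => hmid j hj.ne v hv) u hu
  have hmid_high : ∀ u ∈ ⨆ j > i₀, E j, ∀ v ∈ E i₀, B u v = 0 := fun u hu v hv => by
    rw [hBsymm]
    exact apply_eq_zero_of_mem_biSup B E (· > i₀) v (fun j hj => hmid j hj.ne' v hv) u hu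
  have hsep : ∀ u : E i₀, (∀ v : E i₀, B u v = 0) → u = 0 := fun u hu =>
    Subtype.ext <| hzero u fun j v hv => by
      rcases eq_or_ne j i₀ with rfl | hj
      · exact hu ⟨v, hv⟩
      · exact hmid j hj u u.2 v hv
  refine ⟨hc₀, ⟨hsep, fun u hu => hsep u fun v => (hBsymm u v).trans (hu v)⟩,
    hmid, hlow, hhigh, le_antisymm ?_ ?_⟩
  · refine finrank_le_of_separating_s5 B _ _ fun u hu h => hzero u fun j v hv => ?_
    rcases lt_trichotomy j i₀ with hj | rfl | hj
    · exact hlow u hu v (Submodule.mem_iSup_of_mem j (Submodule.mem_iSup_of_mem hj hv))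
    · exact hmid_low u hu v hv
    · exact h v (Submodule.mem_iSup_of_mem j (Submodule.mem_iSup_of_mem hj hv))
  · refine finrank_le_of_separating_s5 B _ _ fun u hu h => hzero u fun j v hv => ?_
    rcases lt_trichotomy j i₀ with hj | rfl | hj
    · exact h v (Submodule.mem_iSup_of_mem j (Submodule.mem_iSup_of_mem hj hv))
    · exact hmid_high u hu v hv
    · exact hhigh u hu v (Submodule.mem_iSup_of_mem j (Submodule.mem_iSup_of_mem hj hv))
end

section
/- Let p ≥ 1 be an integer, W a real vector space of dimension p + 1, r ≥ 1 an integer with r ≤ 2p + 1, and χ₁, …, χ_r, χ₀ linear functionals on W such that χ_i + χ_{r+1−i} = χ₀ for all 1 ≤ i ≤ r and such that χ₁, …, χ_r span the dual space W*. Then ⌊r/2⌋ = p (so r = 2p or r = 2p + 1), and for every 1 ≤ i ≤ p the subspace P_i = span{χ_i, χ_{r+1−i}} of W* is 2-dimensional and χ_i does not belong to the sum ∑_{1 ≤ j ≤ p, j ≠ i} span{χ_j, χ_{r+1−j}}; in particular P_i is not contained in that sum. -/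
/-- The functional `χ₀` together with the first half of the family `χ`. -/
def halfFamily {V : Type*} {r : ℕ} (χ : Fin r → V) (χ₀ : V) : Option (Fin (r / 2)) → V :=
  fun o => o.elim χ₀ fun k => χ ⟨k, by omega⟩

theorem span_range_halfFamily {V : Type*} [AddCommGroup V] [Module ℝ V] {r : ℕ}
    {χ : Fin r → V} {χ₀ : V} (hrel : ∀ i, χ i + χ i.rev = χ₀)
    (hspan : Submodule.span ℝ (Set.range χ) = ⊤) :
    Submodule.span ℝ (Set.range (halfFamily χ χ₀)) = ⊤ := by
  rw [eq_top_iff, ← hspan, Submodule.span_le]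
  have h0 : χ₀ ∈ Submodule.span ℝ (Set.range (halfFamily χ χ₀)) :=
    Submodule.subset_span ⟨none, rfl⟩
  have hlt (i : Fin r) (hi : (i : ℕ) < r / 2) :
      χ i ∈ Submodule.span ℝ (Set.range (halfFamily χ χ₀)) :=
    Submodule.subset_span ⟨some ⟨i, hi⟩, rfl⟩
  rintro _ ⟨i, rfl⟩
  have hi := i.isLt
  by_cases h1 : (i : ℕ) < r / 2
  · exact hlt i h1
  by_cases h2 : (i.rev : ℕ) < r / 2
  · rw [eq_sub_of_add_eq (hrel i)]
    exact Submodule.sub_mem _ h0 (hlt _ h2)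
  · have h3 : i.rev = i := by
      ext
      rw [Fin.val_rev] at h2 ⊢
      omega
    have h4 : χ i = (1 / 2 : ℝ) • χ₀ := by
      have := hrel i
      rw [h3] at this
      rw [← this]
      module
    rw [h4]
    exact Submodule.smul_mem _ _ h0


theorem stmt7 (p : ℕ) (hp : 1 ≤ p)
    (W : Type*) [AddCommGroup W] [Module ℝ W] [FiniteDimensional ℝ W]
    (hdim : Module.finrank ℝ W = p + 1)
    (r : ℕ) (hr : 1 ≤ r) (hr' : r ≤ 2 * p + 1)
    (χ : Fin r → Module.Dual ℝ W) (χ₀ : Module.Dual ℝ W)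
    (hrel : ∀ i : Fin r, χ i + χ i.rev = χ₀)
    (hspan : Submodule.span ℝ (Set.range χ) = ⊤) :
    r / 2 = p ∧ (r = 2 * p ∨ r = 2 * p + 1) ∧
    ∀ i : Fin r, (i : ℕ) < p →
      Module.finrank ℝ ↥(Submodule.span ℝ {χ i, χ i.rev}) = 2 ∧
      χ i ∉ (⨆ j ∈ {j : Fin r | (j : ℕ) < p ∧ j ≠ i},
        Submodule.span ℝ {χ j, χ j.rev}) ∧
      ¬ (Submodule.span ℝ {χ i, χ i.rev} ≤
        ⨆ j ∈ {j : Fin r | (j : ℕ) < p ∧ j ≠ i},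
          Submodule.span ℝ {χ j, χ j.rev}) := by
  have hbspan := span_range_halfFamily hrel hspan
  have hfin : Module.finrank ℝ (Module.Dual ℝ W) = p + 1 := by
    rw [Subspace.dual_finrank_eq, hdim]
  have hle : p + 1 ≤ r / 2 + 1 := by
    have h := finrank_range_le_card (R := ℝ) (halfFamily χ χ₀)
    rw [Set.finrank, hbspan, finrank_top, hfin] at h
    simpa using h
  have hrp : r / 2 = p := by omega
  refine ⟨hrp, by omega, fun i hi => ?_⟩
  have hli : LinearIndependent ℝ (halfFamily χ χ₀) :=
    linearIndependent_of_top_le_span_of_card_eq_finrank hbspan.ge (by simp [hfin, hrp])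
  have hnot : χ i ∉ ⨆ j ∈ {j : Fin r | (j : ℕ) < p ∧ j ≠ i},
      Submodule.span ℝ {χ j, χ j.rev} := by
    intro hmem
    refine hli.notMem_span_image (s := {some ⟨i, by omega⟩}ᶜ) (x := some ⟨i, by omega⟩)
      (by simp) ?_
    refine (iSup₂_le fun j hj => ?_ : _ ≤ Submodule.span ℝ _) hmem
    obtain ⟨hjp, hji⟩ := hj
    have hj : χ j ∈ Submodule.span ℝ
        (halfFamily χ χ₀ '' {some ⟨i, by omega⟩}ᶜ) :=
      Submodule.subset_span ⟨some ⟨j, by omega⟩, by simpa [Fin.ext_iff] using hji, rfl⟩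
    have h0 : χ₀ ∈ Submodule.span ℝ (halfFamily χ χ₀ '' {some ⟨i, by omega⟩}ᶜ) :=
      Submodule.subset_span ⟨none, by simp, rfl⟩
    rw [Submodule.span_le, Set.pair_subset_iff]
    refine ⟨hj, ?_⟩
    rw [eq_sub_of_add_eq' (hrel j)]
    exact Submodule.sub_mem _ h0 hj
  refine ⟨?_, hnot, fun h => hnot (h (Submodule.subset_span (by simp)))⟩
  have hpair : LinearIndependent ℝ ![χ i, χ₀] := by
    have h := hli.comp ![some ⟨i, by omega⟩, none] (by
      intro a b
      fin_cases a <;> fin_cases b <;> simp)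
    convert h using 1
    ext k : 1
    fin_cases k <;> rfl
  have hpair' : LinearIndependent ℝ ![χ i, χ i.rev] := by
    rw [LinearIndependent.pair_iff] at hpair ⊢
    intro s t hst
    have h := hpair (s - t) t (by
      rw [← hst, ← hrel i]
      module)
    exact ⟨by linarith [h.1, h.2], h.2⟩
  rw [← Matrix.range_cons_cons_empty (χ i) (χ i.rev) ![]]
  simpa using finrank_span_eq_card hpair'
end

section
/- Let p ≥ 0 be an integer, W a real vector space of dimension p + 1, r an integer equal to 2p or to 2p + 1, and χ₁, …, χ_r, χ₀ linear functionals on W such that χ_i + χ_{r+1−i} = χ₀ for all 1 ≤ i ≤ r and such that χ₁, …, χ_r span the dual space W*. Then there exists a unique vector X ∈ W such that χ_i(X) = −1 for all 1 ≤ i ≤ r. -/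
/-- Two vectors at which a spanning family of functionals takes the same values are equal. -/
theorem eq_of_span_dual_eq_top {ι K V : Type*} [Field K] [AddCommGroup V] [Module K V]
    {f : ι → Module.Dual K V} (hf : Submodule.span K (Set.range f) = ⊤) {x y : V}
    (h : ∀ i, f i x = f i y) : x = y := by
  have hev : Module.Dual.eval K V x = Module.Dual.eval K V y := by
    refine LinearMap.ext_on hf ?_
    rintro _ ⟨i, rfl⟩
    exact h i
  exact Module.eval_apply_injective K hev

/-- A spanning family of `dim V` functionals can be given arbitrary values at a vector. -/
theorem exists_dual_apply_eq_of_span_eq_top {ι K V : Type*} [Fintype ι] [Field K]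
    [AddCommGroup V] [Module K V] [FiniteDimensional K V]
    {f : ι → Module.Dual K V} (hf : Submodule.span K (Set.range f) = ⊤)
    (hcard : Fintype.card ι = Module.finrank K V) (c : ι → K) :
    ∃ x : V, ∀ i, f i x = c i := by
  have hli : LinearIndependent K f :=
    linearIndependent_of_top_le_span_of_card_eq_finrank hf.ge
      (hcard.trans Subspace.dual_finrank_eq.symm)
  let b := Module.Basis.mk hli hf.ge
  refine ⟨(Module.evalEquiv K V).symm (b.constr K c), fun i => ?_⟩
  rw [Module.apply_evalEquiv_symm_apply]
  simpa [b] using b.constr_basis K c i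

theorem stmt8 (p : ℕ)
    (W : Type*) [AddCommGroup W] [Module ℝ W] [FiniteDimensional ℝ W]
    (hdim : Module.finrank ℝ W = p + 1)
    (r : ℕ) (hr : r = 2 * p ∨ r = 2 * p + 1)
    (χ : Fin r → Module.Dual ℝ W) (χ₀ : Module.Dual ℝ W)
    (hrel : ∀ i : Fin r, χ i + χ i.rev = χ₀)
    (hspan : Submodule.span ℝ (Set.range χ) = ⊤) :
    ∃! X : W, ∀ i : Fin r, χ i X = -1 := by
  have hpr : p ≤ r := by omega
  have hcases (i : Fin r) : (i : ℕ) < p ∨ (i.rev : ℕ) < p ∨ i.rev = i := by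
    rw [Fin.ext_iff, Fin.val_rev]
    omega
  let v : Option (Fin p) → Module.Dual ℝ W := fun o => o.elim χ₀ fun i => χ (i.castLE hpr)
  have hv : Submodule.span ℝ (Set.range v) = ⊤ := by
    rw [eq_top_iff, ← hspan, Submodule.span_le]
    rintro _ ⟨i, rfl⟩
    have h₀ : χ₀ ∈ Submodule.span ℝ (Set.range v) := Submodule.subset_span ⟨none, rfl⟩
    have hlow (j : Fin r) (hj : (j : ℕ) < p) : χ j ∈ Submodule.span ℝ (Set.range v) :=
      Submodule.subset_span ⟨some ⟨j, hj⟩, rfl⟩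
    rcases hcases i with hi | hi | hi
    · exact hlow i hi
    · rw [eq_sub_of_add_eq (hrel i)]
      exact sub_mem h₀ (hlow _ hi)
    · have h := hrel i
      rw [hi, ← two_smul ℝ] at h
      rw [← h] at h₀
      exact (Submodule.smul_mem_iff _ two_ne_zero).1 h₀
  obtain ⟨X, hX⟩ := exists_dual_apply_eq_of_span_eq_top hv (by simp [hdim])
    fun o => o.elim (-2) fun _ => -1
  have hX₀ : χ₀ X = -2 := hX none
  have hlow (j : Fin r) (hj : (j : ℕ) < p) : χ j X = -1 := hX (some ⟨j, hj⟩)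
  have hX' (i : Fin r) : χ i X = -1 := by
    have h : χ i X + χ i.rev X = -2 := by rw [← LinearMap.add_apply, hrel, hX₀]
    rcases hcases i with hi | hi | hi
    · exact hlow i hi
    · linarith [hlow _ hi]
    · rw [hi] at h
      linarith
  exact ⟨X, hX', fun Y hY => eq_of_span_dual_eq_top hspan fun i => (hY i).trans (hX' i).symm⟩
end

section
/- The vector −e₁ is the unique element u of L₁ with the following property: for every v ∈ L₁ with v ≠ u there exist w ∈ L₁ with w ≠ u and w ≠ v, and real numbers a ≥ 0 and b ≥ 0, such that u = a·v + b·w. -/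
noncomputable def e4 : Fin 4 → EuclideanSpace ℝ (Fin 4) :=
  fun i => EuclideanSpace.single i (1 : ℝ)

/-- The 15-element set of Section 5.2, case `j₀ = 4`, for `F₄`. -/
noncomputable def L₁ : Set (EuclideanSpace ℝ (Fin 4)) :=
  {-(e4 0)} ∪
  {v | ∃ i : Fin 4, (i = 1 ∨ i = 2 ∨ i = 3) ∧ ∃ ε : ℝ, (ε = 1 ∨ ε = -1) ∧
    v = -(e4 0) + ε • e4 i} ∪
  {v | ∃ ε₂ ε₃ ε₄ : ℝ, (ε₂ = 1 ∨ ε₂ = -1) ∧ (ε₃ = 1 ∨ ε₃ = -1) ∧ (ε₄ = 1 ∨ ε₄ = -1) ∧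
    v = (2 : ℝ)⁻¹ • (-(e4 0) + ε₂ • e4 1 + ε₃ • e4 2 + ε₄ • e4 3)}

theorem e4_apply (i j : Fin 4) : e4 i j = if j = i then 1 else 0 := by
  simp [e4]

theorem eq_of_eq_nonneg_mul {ε δ b : ℝ} (hε : ε = 1 ∨ ε = -1) (hδ : δ = 1 ∨ δ = -1)
    (hb : 0 ≤ b) (h : ε = b * δ) : ε = δ := by
  rcases hε with rfl | rfl <;> rcases hδ with rfl | rfl <;> first | rfl | linarith

theorem ne_zero_of_eq_one_or_neg_one {ε : ℝ} (hε : ε = 1 ∨ ε = -1) : ε ≠ 0 := by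
  rcases hε with rfl | rfl <;> norm_num

/-- An element of `L₁` other than `-e₁` is determined, among the elements of `L₁`, by the
direction of its projection orthogonal to `e₁`. -/
theorem eq_of_apply_eq_nonneg_mul {u w : EuclideanSpace ℝ (Fin 4)} (hu : u ∈ L₁) (hw : w ∈ L₁)
    (hu₀ : u ≠ -(e4 0)) {b : ℝ} (hb : 0 ≤ b) (h : ∀ i : Fin 4, i ≠ 0 → u i = b * w i) :
    w = u := by
  have h1 := h 1 (by decide)
  have h2 := h 2 (by decide)
  have h3 := h 3 (by decide)
  rcases hu with (hu | ⟨i, hi, ε, hε, rfl⟩) | ⟨ε₂, ε₃, ε₄, hε₂, hε₃, hε₄, rfl⟩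
  · exact absurd hu hu₀
  · have hε₀ := ne_zero_of_eq_one_or_neg_one hε
    rcases hw with (rfl | ⟨j, hj, δ, hδ, rfl⟩) | ⟨δ₂, δ₃, δ₄, hδ₂, hδ₃, hδ₄, rfl⟩
    · rcases hi with rfl | rfl | rfl <;> simp [e4_apply, hε₀] at h1 h2 h3
    · rcases hi with rfl | rfl | rfl <;> rcases hj with rfl | rfl | rfl <;>
        simp [e4_apply, hε₀] at h1 h2 h3 <;>
        rw [eq_of_eq_nonneg_mul hε hδ hb (by assumption)]
    · have hδ₂' := ne_zero_of_eq_one_or_neg_one hδ₂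
      have hδ₃' := ne_zero_of_eq_one_or_neg_one hδ₃
      have hδ₄' := ne_zero_of_eq_one_or_neg_one hδ₄
      rcases hi with rfl | rfl | rfl <;>
        simp [e4_apply, hδ₂', hδ₃', hδ₄'] at h1 h2 h3 <;> simp_all
  · have hε₂' := ne_zero_of_eq_one_or_neg_one hε₂
    have hε₃' := ne_zero_of_eq_one_or_neg_one hε₃
    rcases hw with (rfl | ⟨j, hj, δ, hδ, rfl⟩) | ⟨δ₂, δ₃, δ₄, hδ₂, hδ₃, hδ₄, rfl⟩
    · simp [e4_apply, hε₂'] at h1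
    · rcases hj with rfl | rfl | rfl <;> simp [e4_apply, hε₂', hε₃'] at h1 h2 h3
    · simp [e4_apply] at h1 h2 h3
      rw [eq_of_eq_nonneg_mul hε₂ hδ₂ hb (by linarith),
        eq_of_eq_nonneg_mul hε₃ hδ₃ hb (by linarith),
        eq_of_eq_nonneg_mul hε₄ hδ₄ hb (by linarith)]

theorem neg_eq_one_or_neg_one {ε : ℝ} (hε : ε = 1 ∨ ε = -1) : -ε = 1 ∨ -ε = -1 := by
  rcases hε with rfl | rfl <;> simp

theorem stmt11 :
    (-(e4 0)) ∈ L₁ ∧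
    (∀ v ∈ L₁, v ≠ -(e4 0) → ∃ w ∈ L₁, w ≠ -(e4 0) ∧ w ≠ v ∧
      ∃ a b : ℝ, 0 ≤ a ∧ 0 ≤ b ∧ -(e4 0) = a • v + b • w) ∧
    (∀ u ∈ L₁,
      (∀ v ∈ L₁, v ≠ u → ∃ w ∈ L₁, w ≠ u ∧ w ≠ v ∧
        ∃ a b : ℝ, 0 ≤ a ∧ 0 ≤ b ∧ u = a • v + b • w) →
      u = -(e4 0)) := by
  have mem : -(e4 0) ∈ L₁ := Or.inl (Or.inl rfl)
  refine ⟨mem, ?_, ?_⟩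
  · rintro v ((hv | ⟨i, hi, ε, hε, rfl⟩) | ⟨ε₂, ε₃, ε₄, hε₂, hε₃, hε₄, rfl⟩) hv₀
    · exact absurd hv hv₀
    · have hε₀ := ne_zero_of_eq_one_or_neg_one hε
      refine ⟨-(e4 0) + (-ε) • e4 i,
        Or.inl (Or.inr ⟨i, hi, -ε, neg_eq_one_or_neg_one hε, rfl⟩), fun h => ?_, fun h => ?_,
        2⁻¹, 2⁻¹, by norm_num, by norm_num, by module⟩
      · have := congrArg (fun x : EuclideanSpace ℝ (Fin 4) => x i) h
        simp [e4_apply, hε₀] at this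
      · have := congrArg (fun x : EuclideanSpace ℝ (Fin 4) => x i) h
        simp [e4_apply] at this
        exact hε₀ (by linarith)
    · have hε₀ := ne_zero_of_eq_one_or_neg_one hε₂
      refine ⟨(2 : ℝ)⁻¹ • (-(e4 0) + (-ε₂) • e4 1 + (-ε₃) • e4 2 + (-ε₄) • e4 3),
        Or.inr ⟨-ε₂, -ε₃, -ε₄, neg_eq_one_or_neg_one hε₂, neg_eq_one_or_neg_one hε₃,
          neg_eq_one_or_neg_one hε₄, rfl⟩, fun h => ?_, fun h => ?_,
        1, 1, by norm_num, by norm_num, by module⟩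
      · have := congrArg (fun x : EuclideanSpace ℝ (Fin 4) => x 1) h
        simp [e4_apply, hε₀] at this
      · have := congrArg (fun x : EuclideanSpace ℝ (Fin 4) => x 1) h
        simp [e4_apply] at this
        exact hε₀ (by linarith)
  · intro u hu h
    by_contra hu₀
    obtain ⟨w, hw, hwu, -, a, b, -, hb, hab⟩ := h _ mem (Ne.symm hu₀)
    refine hwu (eq_of_apply_eq_nonneg_mul hu hw hu₀ hb fun i hi => ?_)
    have := congrArg (fun x : EuclideanSpace ℝ (Fin 4) => x i) hab
    simpa [e4_apply, hi] using this
end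

section
/- The vector −e₁ − e₂ is the unique element u of L₂ with the following property: for every v ∈ L₂ with v ≠ u there exist w ∈ L₂ with w ≠ u and w ≠ v, and real numbers a ≥ 0 and b ≥ 0, such that u = a·v + b·w. -/
/-- The 15-element set of Section 5.2, case `j₀ = 1`, for `F₄`. -/
noncomputable def L₂ : Set (EuclideanSpace ℝ (Fin 4)) :=
  {-(e4 0), -(e4 1), -(e4 0) - e4 1} ∪
  {v | ∃ j : Fin 4, (j = 0 ∨ j = 1) ∧ ∃ i : Fin 4, (i = 2 ∨ i = 3) ∧
    ∃ ε : ℝ, (ε = 1 ∨ ε = -1) ∧ v = -(e4 j) + ε • e4 i} ∪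
  {v | ∃ ε₃ ε₄ : ℝ, (ε₃ = 1 ∨ ε₃ = -1) ∧ (ε₄ = 1 ∨ ε₄ = -1) ∧
    v = (2 : ℝ)⁻¹ • (-(e4 0) - e4 1 + ε₃ • e4 2 + ε₄ • e4 3)}

theorem neg_e4_sub_e4_eq : -(e4 0) - e4 1 = !₂[-1, -1, 0, 0] := by
  ext i; fin_cases i <;> simp [e4]

theorem mem_L₂_iff (v : EuclideanSpace ℝ (Fin 4)) : v ∈ L₂ ↔
    (v = !₂[-1, 0, 0, 0] ∨ v = !₂[0, -1, 0, 0] ∨ v = !₂[-1, -1, 0, 0]) ∨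
    (∃ ε : ℝ, (ε = 1 ∨ ε = -1) ∧ (v = !₂[-1, 0, ε, 0] ∨ v = !₂[-1, 0, 0, ε] ∨
      v = !₂[0, -1, ε, 0] ∨ v = !₂[0, -1, 0, ε])) ∨
    ∃ ε δ : ℝ, (ε = 1 ∨ ε = -1) ∧ (δ = 1 ∨ δ = -1) ∧ v = !₂[-1 / 2, -1 / 2, ε / 2, δ / 2] := by
  have h₀ : -(e4 0) = !₂[-1, 0, 0, 0] := by ext i; fin_cases i <;> simp [e4]
  have h₁ : -(e4 1) = !₂[0, -1, 0, 0] := by ext i; fin_cases i <;> simp [e4]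
  have h₀₂ (ε : ℝ) : -(e4 0) + ε • e4 2 = !₂[-1, 0, ε, 0] := by
    ext i; fin_cases i <;> simp [e4]
  have h₀₃ (ε : ℝ) : -(e4 0) + ε • e4 3 = !₂[-1, 0, 0, ε] := by
    ext i; fin_cases i <;> simp [e4]
  have h₁₂ (ε : ℝ) : -(e4 1) + ε • e4 2 = !₂[0, -1, ε, 0] := by
    ext i; fin_cases i <;> simp [e4]
  have h₁₃ (ε : ℝ) : -(e4 1) + ε • e4 3 = !₂[0, -1, 0, ε] := by
    ext i; fin_cases i <;> simp [e4]
  have hh (ε δ : ℝ) : (2 : ℝ)⁻¹ • (-(e4 0) - e4 1 + ε • e4 2 + δ • e4 3) =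
      !₂[-1 / 2, -1 / 2, ε / 2, δ / 2] := by
    ext i; fin_cases i <;> simp [e4] <;> ring
  simp only [L₂, Set.mem_union, Set.mem_insert_iff, Set.mem_singleton_iff, Set.mem_ofPred_eq, hh]
  simp only [or_and_right, and_or_left, exists_or, exists_eq_left, exists_and_left, h₀₂, h₀₃, h₁₂,
    h₁₃, neg_e4_sub_e4_eq]
  rw [h₀, h₁]
  tauto

/-- An element of `L₂` is `-e₁ - e₂`, or vanishes in exactly one of its first two coordinates, or is
a half-integral vector. -/
theorem mem_L₂_cases {v : EuclideanSpace ℝ (Fin 4)} (hv : v ∈ L₂) :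
    v = !₂[-1, -1, 0, 0] ∨
    (∃ s t : ℝ, (s = 0 ∨ s = 1 ∨ s = -1) ∧ (t = 0 ∨ t = 1 ∨ t = -1) ∧ s * t = 0 ∧
      (v = !₂[-1, 0, s, t] ∨ v = !₂[0, -1, s, t])) ∨
    ∃ s t : ℝ, (s = 1 ∨ s = -1) ∧ (t = 1 ∨ t = -1) ∧ v = !₂[-1 / 2, -1 / 2, s / 2, t / 2] := by
  rcases (mem_L₂_iff v).1 hv with (h | h | h) | ⟨ε, hε, h | h | h | h⟩ | h
  · exact .inr <| .inl ⟨0, 0, by simp, by simp, by simp, .inl h⟩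
  · exact .inr <| .inl ⟨0, 0, by simp, by simp, by simp, .inr h⟩
  · exact .inl h
  · exact .inr <| .inl ⟨ε, 0, .inr hε, by simp, by simp, .inl h⟩
  · exact .inr <| .inl ⟨0, ε, by simp, .inr hε, by simp, .inl h⟩
  · exact .inr <| .inl ⟨ε, 0, .inr hε, by simp, by simp, .inr h⟩
  · exact .inr <| .inl ⟨0, ε, by simp, .inr hε, by simp, .inr h⟩
  · exact .inr <| .inr h

theorem exists_complement {v : EuclideanSpace ℝ (Fin 4)} (hv : v ∈ L₂)
    (hne : v ≠ !₂[-1, -1, 0, 0]) :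
    ∃ w ∈ L₂, w ≠ !₂[-1, -1, 0, 0] ∧ w ≠ v ∧ !₂[-1, -1, 0, 0] = v + w := by
  have key {x y z t : ℝ} (h : v = !₂[x, y, z, t])
      (hw : !₂[-1 - x, -1 - y, -z, -t] ∈ L₂) (h0 : ¬(x = 0 ∧ y = 0))
      (h1 : ¬(x = -1 / 2 ∧ y = -1 / 2 ∧ z = 0)) :
      ∃ w ∈ L₂, w ≠ !₂[-1, -1, 0, 0] ∧ w ≠ v ∧ !₂[-1, -1, 0, 0] = v + w := by
    refine ⟨_, hw, ?_, ?_, ?_⟩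
    · simp; grind
    · rw [h]; simp; grind
    · rw [h]; ext i; fin_cases i <;> simp
  rcases (mem_L₂_iff v).1 hv with (h | h | h) | ⟨ε, hε, h | h | h | h⟩ | ⟨ε, δ, hε, hδ, h⟩
  · exact key h ((mem_L₂_iff _).2 <| by simp) (by simp) (by norm_num)
  · exact key h ((mem_L₂_iff _).2 <| by simp) (by simp) (by norm_num)
  · exact absurd h hne
  · exact key h ((mem_L₂_iff _).2 <| .inr <| .inl ⟨-ε, by grind, by simp⟩) (by simp) (by norm_num)
  · exact key h ((mem_L₂_iff _).2 <| .inr <| .inl ⟨-ε, by grind, by simp⟩) (by simp) (by norm_num)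
  · exact key h ((mem_L₂_iff _).2 <| .inr <| .inl ⟨-ε, by grind, by simp⟩) (by simp) (by norm_num)
  · exact key h ((mem_L₂_iff _).2 <| .inr <| .inl ⟨-ε, by grind, by simp⟩) (by simp) (by norm_num)
  · exact key h ((mem_L₂_iff _).2 <| .inr <| .inr
      ⟨-ε, -δ, by grind, by grind, by norm_num [neg_div]⟩) (by norm_num) (by grind)

theorem eq_of_eq_smul_add_smul_of_apply_one {u w : EuclideanSpace ℝ (Fin 4)} {s t a b : ℝ}
    (hu : u = !₂[-1, 0, s, t]) (hw : w ∈ L₂) (ha : 0 ≤ a)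
    (h : u = a • !₂[0, -1, 0, 0] + b • w) : w = u := by
  have h0 := congrArg (fun x ↦ x.ofLp 0) h
  have h1 := congrArg (fun x ↦ x.ofLp 1) h
  have h2 := congrArg (fun x ↦ x.ofLp 2) h
  have h3 := congrArg (fun x ↦ x.ofLp 3) h
  rcases mem_L₂_cases hw with hw | ⟨s', t', -, -, -, hw | hw⟩ | ⟨s', t', -, -, hw⟩ <;>
  · simp [hu, hw] at h0 h1 h2 h3
    try (rw [hu, hw]; simp; grind)

theorem eq_of_eq_smul_add_smul_of_apply_zero {u w : EuclideanSpace ℝ (Fin 4)} {s t a b : ℝ}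
    (hu : u = !₂[0, -1, s, t]) (hw : w ∈ L₂) (ha : 0 ≤ a)
    (h : u = a • !₂[-1, 0, 0, 0] + b • w) : w = u := by
  have h0 := congrArg (fun x ↦ x.ofLp 0) h
  have h1 := congrArg (fun x ↦ x.ofLp 1) h
  have h2 := congrArg (fun x ↦ x.ofLp 2) h
  have h3 := congrArg (fun x ↦ x.ofLp 3) h
  rcases mem_L₂_cases hw with hw | ⟨s', t', -, -, -, hw | hw⟩ | ⟨s', t', -, -, hw⟩ <;>
  · simp [hu, hw] at h0 h1 h2 h3
    try (rw [hu, hw]; simp; grind)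

theorem eq_of_eq_smul_add_smul_of_half {u w : EuclideanSpace ℝ (Fin 4)} {s t a b : ℝ}
    (hs : s = 1 ∨ s = -1) (ht : t = 1 ∨ t = -1)
    (hu : u = !₂[-1 / 2, -1 / 2, s / 2, t / 2]) (hw : w ∈ L₂) (ha : 0 ≤ a)
    (h : u = a • !₂[-1 / 2, -1 / 2, -s / 2, -t / 2] + b • w) : w = u := by
  have h0 := congrArg (fun x ↦ x.ofLp 0) h
  have h1 := congrArg (fun x ↦ x.ofLp 1) h
  have h2 := congrArg (fun x ↦ x.ofLp 2) h
  have h3 := congrArg (fun x ↦ x.ofLp 3) h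
  rcases mem_L₂_cases hw with hw | ⟨s', t', -, -, hst, hw | hw⟩ | ⟨s', t', hs', ht', hw⟩
  · simp [hu, hw] at h0 h1 h2 h3
    grind
  · simp [hu, hw] at h0 h1 h2 h3
    grind
  · simp [hu, hw] at h0 h1 h2 h3
    grind
  · simp [hu, hw] at h0 h1 h2 h3
    rw [hu, hw]; simp; grind

theorem stmt12 :
    (-(e4 0) - e4 1) ∈ L₂ ∧
    (∀ v ∈ L₂, v ≠ -(e4 0) - e4 1 → ∃ w ∈ L₂, w ≠ -(e4 0) - e4 1 ∧ w ≠ v ∧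
      ∃ a b : ℝ, 0 ≤ a ∧ 0 ≤ b ∧ -(e4 0) - e4 1 = a • v + b • w) ∧
    (∀ u ∈ L₂,
      (∀ v ∈ L₂, v ≠ u → ∃ w ∈ L₂, w ≠ u ∧ w ≠ v ∧
        ∃ a b : ℝ, 0 ≤ a ∧ 0 ≤ b ∧ u = a • v + b • w) →
      u = -(e4 0) - e4 1) := by
  rw [neg_e4_sub_e4_eq]
  refine ⟨by simp [mem_L₂_iff], fun v hv hne ↦ ?_, fun u hu h ↦ ?_⟩
  · obtain ⟨w, hw, hwu, hwv, hsum⟩ := exists_complement hv hne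
    exact ⟨w, hw, hwu, hwv, 1, 1, zero_le_one, zero_le_one, by simpa using hsum⟩
  · rcases mem_L₂_cases hu with hu | ⟨s, t, -, -, -, hu | hu⟩ | ⟨s, t, hs, ht, hu⟩
    · exact hu
    · obtain ⟨w, hw, hwu, -, a, b, ha, hb, hab⟩ :=
        h !₂[0, -1, 0, 0] (by simp [mem_L₂_iff]) (by simp [hu])
      exact absurd (eq_of_eq_smul_add_smul_of_apply_one hu hw ha hab) hwu
    · obtain ⟨w, hw, hwu, -, a, b, ha, hb, hab⟩ :=
        h !₂[-1, 0, 0, 0] (by simp [mem_L₂_iff]) (by simp [hu])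
      exact absurd (eq_of_eq_smul_add_smul_of_apply_zero hu hw ha hab) hwu
    · obtain ⟨w, hw, hwu, -, a, b, ha, hb, hab⟩ :=
        h !₂[-1 / 2, -1 / 2, -s / 2, -t / 2]
          ((mem_L₂_iff _).2 <| .inr <| .inr ⟨-s, -t, by grind, by grind, rfl⟩)
          (by rw [hu]; simp; grind)
      exact absurd (eq_of_eq_smul_add_smul_of_half hs ht hu hw ha hab) hwu
end

section
/- The vector −e₈ − e₇ is the unique element u of L₃ with the following property: for every v ∈ L₃ with v ≠ u there exist w ∈ L₃ with w ≠ u and w ≠ v, and real numbers a ≥ 0 and b ≥ 0, such that u = a·v + b·w. -/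
open scoped Classical

noncomputable def e8 : Fin 8 → EuclideanSpace ℝ (Fin 8) :=
  fun i => EuclideanSpace.single i (1 : ℝ)

/-- The 57-element set of Section 5.4, for `E₈` (here `e₈, e₇` are the basis vectors
of indices `7, 6`, and `e_i`, `1 ≤ i ≤ 6`, those of indices `0, …, 5`). -/
noncomputable def L₃ : Set (EuclideanSpace ℝ (Fin 8)) :=
  {-(e8 7) - e8 6} ∪
  {v | ∃ j : Fin 8, (j = 7 ∨ j = 6) ∧ ∃ i : Fin 8, (i : ℕ) < 6 ∧
    ∃ ε : ℝ, (ε = 1 ∨ ε = -1) ∧ v = -(e8 j) + ε • e8 i} ∪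
  {v | ∃ ε : Fin 6 → ℝ, (∀ i, ε i = 1 ∨ ε i = -1) ∧
    Even (Finset.univ.filter (fun i => ε i = -1)).card ∧
    v = (2 : ℝ)⁻¹ • (-(e8 7) - e8 6 +
      ∑ i : Fin 6, ε i • e8 (i.castLE (by norm_num)))}

lemma e8_apply (i j : Fin 8) : e8 i j = if j = i then 1 else 0 := by
  simp [e8]

lemma L₃_coordinates {v : EuclideanSpace ℝ (Fin 8)} (hv : v ∈ L₃)
    (hne : v ≠ -(e8 7) - e8 6) : v 6 + v 7 = -1 ∧ ∑ i, v i ^ 2 = 2 := by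
  rcases hv with (hv | ⟨j, hj, i, hi, ε, hε, rfl⟩) | ⟨ε, hε, -, rfl⟩
  · exact absurd hv hne
  · have hε2 : ε ^ 2 = 1 := by rcases hε with rfl | rfl <;> norm_num
    rcases hj with rfl | rfl <;> fin_cases i <;>
      simp [Fin.sum_univ_eight, e8_apply] at hi ⊢ <;> linarith
  · have hε2 (i) : ε i ^ 2 = 1 := by rcases hε i with h | h <;> rw [h] <;> norm_num
    simp only [Fin.sum_univ_eight, Fin.sum_univ_six, PiLp.smul_apply, PiLp.add_apply,
      PiLp.sub_apply, PiLp.neg_apply, e8_apply, smul_eq_mul]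
    simp [Fin.ext_iff]
    constructor
    · norm_num
    · simp only [mul_pow, hε2]
      norm_num

lemma exists_L₃_add_eq {v : EuclideanSpace ℝ (Fin 8)} (hv : v ∈ L₃)
    (hne : v ≠ -(e8 7) - e8 6) : ∃ w ∈ L₃, -(e8 7) - e8 6 = v + w := by
  rcases hv with (hv | ⟨j, hj, i, hi, ε, hε, rfl⟩) | ⟨ε, hε, heven, rfl⟩
  · exact absurd hv hne
  · have hε' : -ε = 1 ∨ -ε = -1 := by rcases hε with rfl | rfl <;> simp
    rcases hj with rfl | rfl
    · exact ⟨_, .inl (.inr ⟨6, .inr rfl, i, hi, -ε, hε', rfl⟩), by module⟩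
    · exact ⟨_, .inl (.inr ⟨7, .inl rfl, i, hi, -ε, hε', rfl⟩), by module⟩
  · refine ⟨_, .inr ⟨fun i => -ε i, fun i => ?_, ?_, rfl⟩, ?_⟩
    · rcases hε i with h | h <;> simp [h]
    · have hcompl : Finset.univ.filter (fun i => -ε i = -1) =
          (Finset.univ.filter (fun i => ε i = -1))ᶜ := by
        ext i
        rcases hε i with h | h <;> norm_num [h]
      rw [hcompl, Finset.card_compl, Fintype.card_fin]
      exact (Nat.even_sub (card_finset_fin_le _)).mpr (iff_of_true (by decide) heven)
    · simp only [neg_smul, Finset.sum_neg_distrib]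
      module

lemma eq_of_mem_L₃_of_eq_smul_add_smul {u w : EuclideanSpace ℝ (Fin 8)} (hu : u ∈ L₃)
    (hu₀ : u ≠ -(e8 7) - e8 6) (hw : w ∈ L₃) (hw₀ : w ≠ -(e8 7) - e8 6) {a b : ℝ}
    (hb : 0 ≤ b) (h : u = a • (-(e8 7) - e8 6) + b • w) : u = w := by
  obtain ⟨hu1, hu2⟩ := L₃_coordinates hu hu₀
  obtain ⟨hw1, hw2⟩ := L₃_coordinates hw hw₀
  have hc (i : Fin 8) : u i = a * (-(if i = 7 then 1 else 0) - if i = 6 then 1 else 0) +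
      b * w i := by
    rw [h]
    simp [e8_apply]
  rw [Fin.sum_univ_eight] at hu2 hw2
  simp only [hc] at hu1 hu2
  simp [Fin.ext_iff] at hu1 hu2
  have hab : b = 1 - 2 * a := by linear_combination b * hw1 - hu1
  have ha : a * (a - 1) = 0 := by
    subst hab
    linear_combination hu2 / 6 - (1 - 2 * a) ^ 2 / 6 * hw2 + a * (1 - 2 * a) / 3 * hw1
  rcases mul_eq_zero.mp ha with ha | ha
  · subst ha
    simpa [hab] using h
  · linarith

theorem stmt13 :
    (-(e8 7) - e8 6) ∈ L₃ ∧
    (∀ v ∈ L₃, v ≠ -(e8 7) - e8 6 → ∃ w ∈ L₃, w ≠ -(e8 7) - e8 6 ∧ w ≠ v ∧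
      ∃ a b : ℝ, 0 ≤ a ∧ 0 ≤ b ∧ -(e8 7) - e8 6 = a • v + b • w) ∧
    (∀ u ∈ L₃,
      (∀ v ∈ L₃, v ≠ u → ∃ w ∈ L₃, w ≠ u ∧ w ≠ v ∧
        ∃ a b : ℝ, 0 ≤ a ∧ 0 ≤ b ∧ u = a • v + b • w) →
      u = -(e8 7) - e8 6) := by
  have h₀ : -(e8 7) - e8 6 ∈ L₃ := .inl (.inl rfl)
  refine ⟨h₀, fun v hv hne => ?_, fun u hu h => ?_⟩
  · obtain ⟨w, hw, hsum⟩ := exists_L₃_add_eq hv hne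
    obtain ⟨hv1, -⟩ := L₃_coordinates hv hne
    refine ⟨w, hw, ?_, ?_, 1, 1, zero_le_one, zero_le_one, by simpa using hsum⟩
    · rintro rfl
      have hv0 : v = 0 := by simpa using hsum
      simp [hv0] at hv1
    · rintro rfl
      obtain ⟨-, hw2⟩ := L₃_coordinates hv hne
      have hc (i : Fin 8) : w i = (-(if i = 7 then 1 else 0) - if i = 6 then 1 else 0) / 2 := by
        have := congrArg (fun x => x i) hsum
        simp [e8_apply] at this
        linarith
      rw [Fin.sum_univ_eight] at hw2
      simp only [hc] at hw2
      simp [Fin.ext_iff] at hw2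
      norm_num at hw2
  · by_contra hne
    obtain ⟨w, hw, hwu, hw₀, a, b, -, hb, heq⟩ := h _ h₀ (Ne.symm hne)
    exact hwu (eq_of_mem_L₃_of_eq_smul_add_smul hu hne hw hw₀ hb heq).symm
end

section
/- There is no element u of L₄ with the following property: for every v ∈ L₄ with v ≠ u there exists w ∈ L₄ with w ≠ u and w ≠ v such that u lies in the real linear span of {v, w}. -/
open scoped Classical

/-- The 27-element set of Section 5.5, for `E₇` (here `e₈, e₇, e₆` are the basis
vectors of indices `7, 6, 5`, and `e_i`, `1 ≤ i ≤ 5`, those of indices `0, …, 4`). -/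
noncomputable def L₄ : Set (EuclideanSpace ℝ (Fin 8)) :=
  {-(e8 7) + e8 6} ∪
  {v | ∃ i : Fin 8, (i : ℕ) < 5 ∧ ∃ ε : ℝ, (ε = 1 ∨ ε = -1) ∧
    v = -(e8 5) + ε • e8 i} ∪
  {v | ∃ ε : Fin 5 → ℝ, (∀ i, ε i = 1 ∨ ε i = -1) ∧
    Even (Finset.univ.filter (fun i => ε i = -1)).card ∧
    v = (2 : ℝ)⁻¹ • (-(e8 7) + e8 6 - e8 5 +
      ∑ i : Fin 5, ε i • e8 (i.castLE (by norm_num)))}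

theorem sub_apply_eq_one_of_mem_L₄ {v : EuclideanSpace ℝ (Fin 8)} (hv : v ∈ L₄) :
    v 6 - v 5 = 1 := by
  rcases hv with (rfl | ⟨i, hi, ε, -, rfl⟩) | ⟨ε, -, -, rfl⟩
  · simp [e8]
  · have h5 : (5 : Fin 8) ≠ i := by rintro rfl; simp at hi
    have h6 : (6 : Fin 8) ≠ i := by rintro rfl; simp at hi
    simp [e8, h5, h6]
  · simp [e8, Fin.sum_univ_five, Fin.ext_iff]
    norm_num

theorem inner_self_of_mem_L₄ {v : EuclideanSpace ℝ (Fin 8)} (hv : v ∈ L₄) :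
    inner ℝ v v = 2 := by
  rcases hv with (rfl | ⟨i, hi, ε, hε, rfl⟩) | ⟨ε, hε, -, rfl⟩
  · rw [PiLp.inner_apply]
    simp [e8, Fin.sum_univ_eight]
    norm_num
  · have h5 : i ≠ 5 := by rintro rfl; simp at hi
    have hs : ε * ε = 1 := by rcases hε with rfl | rfl <;> norm_num
    simp only [e8, inner_add_left, inner_add_right, inner_neg_left, inner_neg_right,
      inner_smul_left, inner_smul_right, EuclideanSpace.inner_single_left]
    simp [h5, h5.symm, hs]
    norm_num
  · have hs (i : Fin 5) : ε i ^ 2 = 1 := by rcases hε i with h | h <;> norm_num [h]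
    rw [PiLp.inner_apply]
    simp [e8, Fin.sum_univ_eight, Fin.sum_univ_five]
    linear_combination (hs 0 + hs 1 + hs 2 + hs 3 + hs 4) / 4

/-- A line meets a sphere centred at the origin in at most two points. -/
theorem eq_or_eq_of_inner_self_eq {E : Type*} [NormedAddCommGroup E] [InnerProductSpace ℝ E]
    {v w : E} {r a b : ℝ} (hab : a + b = 1) (hv : inner ℝ v v = r) (hw : inner ℝ w w = r)
    (hu : inner ℝ (a • v + b • w) (a • v + b • w) = r) (hvw : w ≠ v) :
    a • v + b • w = v ∨ a • v + b • w = w := by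
  obtain rfl : b = 1 - a := by linarith
  have hne : inner ℝ (w - v) (w - v) ≠ 0 := by
    simpa [sub_eq_zero] using hvw
  have hprod : a * (1 - a) * inner ℝ (w - v) (w - v) = 0 := by
    simp only [inner_add_left, inner_add_right, inner_smul_left, inner_smul_right,
      inner_sub_left, inner_sub_right, real_inner_comm v w, hv, hw, conj_trivial] at hu ⊢
    linarith
  rcases mul_eq_zero.mp ((mul_eq_zero.mp hprod).resolve_right hne) with h | h
  · right; simp [h]
  · left
    obtain rfl : a = 1 := by linarith
    simp

theorem L₄_nontrivial : L₄.Nontrivial := by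
  refine ⟨-(e8 7) + e8 6, Or.inl (Or.inl rfl), -(e8 5) + (1 : ℝ) • e8 0,
    Or.inl (Or.inr ⟨0, by simp, 1, Or.inl rfl, rfl⟩), fun h => ?_⟩
  simpa [e8] using congrArg (fun x : EuclideanSpace ℝ (Fin 8) => x 5) h

theorem stmt14 :
    ¬ ∃ u ∈ L₄, ∀ v ∈ L₄, v ≠ u → ∃ w ∈ L₄, w ≠ u ∧ w ≠ v ∧
      u ∈ Submodule.span ℝ ({v, w} : Set (EuclideanSpace ℝ (Fin 8))) := by
  rintro ⟨u, hu, h⟩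
  obtain ⟨v, hv, hvu⟩ := L₄_nontrivial.exists_ne u
  obtain ⟨w, hw, hwu, hwv, hspan⟩ := h v hv hvu
  obtain ⟨a, b, rfl⟩ := Submodule.mem_span_pair.mp hspan
  have hab : a + b = 1 := by
    have h₁ := sub_apply_eq_one_of_mem_L₄ hv
    have h₂ := sub_apply_eq_one_of_mem_L₄ hw
    have h₃ := sub_apply_eq_one_of_mem_L₄ hu
    simp only [PiLp.add_apply, PiLp.smul_apply, smul_eq_mul] at h₃
    linear_combination h₃ - a * h₁ - b * h₂
  rcases eq_or_eq_of_inner_self_eq hab (inner_self_of_mem_L₄ hv) (inner_self_of_mem_L₄ hw)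
    (inner_self_of_mem_L₄ hu) hwv with h | h
  · exact hvu h.symm
  · exact hwu h.symm
end
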